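/- arXiv:1912.08080 — 2 statements merged into one kernel-verified Lean document; each statement's English description precedes it below -/
import Mathlib

section
/- Let H be a 3-uniform hypergraph on 7 vertices with transversal number at least 3, containing no C₃^(3) and no K₄^(3). Then H is isomorphic to one of exactly six hypergraphs: the chordless circular 7-cycle C₇^(3), the Fano plane F, the Fano plane minus one line F⁻, or the hypergraphs C, D, D⁺. -/
/-- `H` is a 3-uniform hypergraph: every edge has 3 vertices. -/
def IsUniform3 (E : Finset (Finset (Fin 7))) : Prop := ∀ e ∈ E, e.card = 3

/-- Some set of at most 2 vertices meets every edge (transversal number ≤ 2). -/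
def HasSmallTransversal (E : Finset (Finset (Fin 7))) : Prop :=
  ∃ T : Finset (Fin 7), T.card ≤ 2 ∧ ∀ e ∈ E, (e ∩ T).Nonempty

/-- `E` contains a `C₃⁽³⁾`: three pairwise intersecting edges, no common
vertex, spanning five vertices. -/
def HasC3 (E : Finset (Finset (Fin 7))) : Prop :=
  ∃ e₁ ∈ E, ∃ e₂ ∈ E, ∃ e₃ ∈ E, e₁ ≠ e₂ ∧ e₂ ≠ e₃ ∧ e₁ ≠ e₃ ∧
    (e₁ ∩ e₂).Nonempty ∧ (e₂ ∩ e₃).Nonempty ∧ (e₁ ∩ e₃).Nonempty ∧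
    e₁ ∩ e₂ ∩ e₃ = ∅ ∧ (e₁ ∪ e₂ ∪ e₃).card = 5

/-- `E` contains a `K₄⁽³⁾`: a 4-set all of whose triples are edges. -/
def HasK4 (E : Finset (Finset (Fin 7))) : Prop :=
  ∃ S : Finset (Fin 7), S.card = 4 ∧ ∀ t ⊆ S, t.card = 3 → t ∈ E

/-- `E'` is isomorphic to `E` via a relabeling of the 7 vertices. -/
def HypIso (E E' : Finset (Finset (Fin 7))) : Prop :=
  ∃ σ : Equiv.Perm (Fin 7), E.image (Finset.image σ) = E'

/-- The chordless circular 7-cycle `C₇⁽³⁾`. -/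
def hypC7 : Finset (Finset (Fin 7)) :=
  {{0,1,2},{1,2,3},{2,3,4},{3,4,5},{4,5,6},{5,6,0},{6,0,1}}

/-- The Fano plane `F`. -/
def hypF : Finset (Finset (Fin 7)) :=
  {{0,1,2},{0,3,4},{0,5,6},{1,3,5},{1,4,6},{2,3,6},{2,4,5}}

/-- The Fano plane minus a line, `F⁻`. -/
def hypFminus : Finset (Finset (Fin 7)) := hypF.erase {2,4,5}

/-- `C`: a spanning 3-star through vertex `0` plus two independent edges. -/
def hypC : Finset (Finset (Fin 7)) := {{0,1,2},{0,3,4},{0,5,6},{1,3,5},{2,4,6}}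

/-- `D`: a 3-wheel centered at `0` plus a spanning triangle of the rest. -/
def hypD : Finset (Finset (Fin 7)) := {{0,1,2},{0,1,3},{0,2,3},{1,4,5},{2,5,6},{3,6,4}}

/-- `D⁺`: `D` plus one more edge. -/
def hypDplus : Finset (Finset (Fin 7)) := hypD ∪ {{4,5,6}}

namespace SevenVertices

/-! Vertex sets are coded by bitmasks below `128`, so that an exhaustive search over hypergraphs
can be evaluated by the kernel. -/

/-- The set of vertices `i` such that bit `i` of `m` is set. -/
def decode (m : ℕ) : Finset (Fin 7) := Finset.univ.filter fun i => m.testBit i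

/-- The number of vertices in the set coded by `m`. -/
def size (m : ℕ) : ℕ := (List.range 7).countP m.testBit

/-- The codes of the `k`-element vertex sets. -/
def codes (k : ℕ) : List ℕ := (List.range 128).filter fun m => Nat.beq (size m) k

/-- The sets coded by `a`, `b`, `c` form a `C₃⁽³⁾`. -/
def isC3 (a b c : ℕ) : Bool :=
  Nat.beq (a &&& b &&& c) 0 && !Nat.beq (a &&& b) 0 && !Nat.beq (b &&& c) 0 &&
    !Nat.beq (a &&& c) 0 && Nat.beq (size (a ||| b ||| c)) 5

/-- The edges in `ins` contain all triples of some 4-set. -/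
def containsK4 (ins : List ℕ) : Bool :=
  (codes 4).any fun s => (List.range 7).all fun i =>
    !s.testBit i || ins.any (Nat.beq (s ^^^ 1 <<< i))

/-- The code of the image of a triple under the map sending `i` to the `i`-th entry of `l`. -/
def imageCode (l : List ℕ) (t : ℕ × ℕ × ℕ) : ℕ :=
  1 <<< l.getD t.1 0 ||| 1 <<< l.getD t.2.1 0 ||| 1 <<< l.getD t.2.2 0

/-- The list of images `l` of the vertices `0, 1, …` can be completed to a permutation of the
vertices mapping the triples in `B` into `ins`. The entries of the list of lists of triples are
the triples to be tested as soon as the next vertices have their images. -/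
def embeds (B : List (ℕ × ℕ × ℕ)) (ins : List ℕ) : List (List (ℕ × ℕ × ℕ)) → List ℕ → Bool
  | [], l => l.isPerm (List.range 7) && B.all fun t => ins.any (Nat.beq (imageCode l t))
  | G :: Gs, l => (List.range 7).any fun v =>
      !l.any (Nat.beq v) && (G.all fun t => ins.any (Nat.beq (imageCode (l ++ [v]) t))) &&
      embeds B ins Gs (l ++ [v])

/-- The edges of the six hypergraphs of the classification; each triple is increasing. -/
def targets : List (List (ℕ × ℕ × ℕ)) :=
  [[(0,1,2), (1,2,3), (2,3,4), (3,4,5), (4,5,6), (0,5,6), (0,1,6)],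
   [(0,1,2), (0,1,3), (0,2,3), (1,4,5), (2,5,6), (3,4,6)],
   [(0,1,2), (0,1,3), (0,2,3), (1,4,5), (2,5,6), (3,4,6), (4,5,6)],
   [(0,1,2), (0,3,4), (0,5,6), (1,3,5), (2,4,6)],
   [(0,1,2), (0,3,4), (0,5,6), (1,3,5), (1,4,6), (2,3,6)],
   [(0,1,2), (0,3,4), (0,5,6), (1,3,5), (1,4,6), (2,3,6), (2,4,5)]]

/-- The hypergraph `ins` contains a `K₄⁽³⁾` or is isomorphic to one of the targets. -/
def isClassified (ins : List ℕ) : Bool :=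
  containsK4 ins || targets.any fun B => Nat.beq B.length ins.length &&
    embeds B ins ((List.range 7).map fun k => B.filter fun t => Nat.beq t.2.2 k) []

/-- Every hypergraph without bad triples of edges that consists of `ins` and some of the edges in
`free` is classified. -/
def checkFree (bad : ℕ → ℕ → ℕ → Bool) : List ℕ → List ℕ → Bool
  | [], ins => isClassified ins
  | c :: free, ins => checkFree bad free ins &&
      ((ins.any fun a => ins.any fun b => bad c a b) || checkFree bad free (c :: ins))

/-- Every hypergraph without bad triples of edges that consists of `ins` and some of the edges in
`free`, and for which none of the sets in the given list is a transversal, is classified. -/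
def checkPairs (bad : ℕ → ℕ → ℕ → Bool) : List ℕ → List ℕ → List ℕ → Bool
  | [], ins, free => checkFree bad free ins
  | T :: Ts, ins, free =>
      if ins.any fun a => Nat.beq (a &&& T) 0 then checkPairs bad Ts ins free
      else (free.filter fun c => Nat.beq (c &&& T) 0).all fun c =>
        checkPairs bad Ts (c :: ins) (free.filter fun e =>
          (!Nat.beq (e &&& T) 0 || Nat.blt c e) && !(c :: ins).any fun a => bad c a e)

/-- The hypergraph with the given list of triples as edges. -/
def toHyp (B : List (ℕ × ℕ × ℕ)) : Finset (Finset (Fin 7)) :=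
  (B.map fun t => {Fin.ofNat 7 t.1, Fin.ofNat 7 t.2.1, Fin.ofNat 7 t.2.2}).toFinset

theorem decode_and (m n : ℕ) : decode (m &&& n) = decode m ∩ decode n := by
  ext i; simp [decode]

theorem decode_or (m n : ℕ) : decode (m ||| n) = decode m ∪ decode n := by
  ext i; simp [decode]

theorem decode_one_shiftLeft : ∀ i < 7, decode (1 <<< i) = {Fin.ofNat 7 i} := by
  decide +kernel

theorem card_decode : ∀ m < 128, (decode m).card = size m := by
  decide +kernel

theorem size_pos : ∀ m < 128, m ≠ 0 → 0 < size m := by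
  decide +kernel

theorem exists_decode : ∀ e : Finset (Fin 7), ∃ m < 128, decode m = e := by
  decide +kernel

theorem mem_codes {k m : ℕ} : m ∈ codes k ↔ m < 128 ∧ size m = k := by
  simp [codes]

theorem exists_mem_codes (e : Finset (Fin 7)) : ∃ m ∈ codes e.card, decode m = e := by
  obtain ⟨m, hm, rfl⟩ := exists_decode e
  exact ⟨m, mem_codes.2 ⟨hm, (card_decode m hm).symm⟩, rfl⟩

theorem decode_nonempty_iff {m : ℕ} (hm : m < 128) : (decode m).Nonempty ↔ m ≠ 0 := by
  rw [← Finset.card_pos, card_decode m hm]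
  refine ⟨?_, size_pos m hm⟩
  rintro h rfl
  exact absurd h (by decide)

theorem decode_xor_one_shiftLeft : ∀ s < 128, ∀ i : Fin 7, s.testBit i = true →
    decode (s ^^^ 1 <<< i.val) = decode s \ {i} := by
  decide +kernel

/-- The hypotheses of the classification. -/
structure Admissible (E : Finset (Finset (Fin 7))) : Prop where
  uniform : IsUniform3 E
  transversal : ¬ HasSmallTransversal E
  noC3 : ¬ HasC3 E
  noK4 : ¬ HasK4 E

/-- `E` is isomorphic to one of the targets. -/
def IsTarget (E : Finset (Finset (Fin 7))) : Prop :=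
  ∃ B ∈ targets, HypIso (toHyp B) E

/-- The code `m` represents an edge of `E`. -/
def CodesEdge (E : Finset (Finset (Fin 7))) (m : ℕ) : Prop :=
  m < 128 ∧ decode m ∈ E

/-- `E` consists of the edges in `ins` and some of those in `free`. -/
structure IsBetween (E : Finset (Finset (Fin 7))) (ins free : List ℕ) : Prop where
  lower : ∀ m ∈ ins, CodesEdge E m
  upper : ∀ m ∈ codes 3, decode m ∈ E → m ∈ ins ∨ m ∈ free

variable {E : Finset (Finset (Fin 7))}

theorem IsUniform3.exists_code (hu : IsUniform3 E) {e : Finset (Fin 7)} (he : e ∈ E) :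
    ∃ m ∈ codes 3, decode m = e :=
  hu e he ▸ exists_mem_codes e

theorem isC3_eq_false (hc3 : ¬ HasC3 E) {a b c : ℕ} (ha : CodesEdge E a) (hb : CodesEdge E b)
    (hc : CodesEdge E c) : isC3 a b c = false := by
  rw [← Bool.not_eq_true]
  intro h
  simp only [isC3, Bool.and_eq_true, Bool.not_eq_true', ← Bool.not_eq_true, Nat.beq_eq] at h
  obtain ⟨⟨⟨⟨habc, hab⟩, hbc⟩, hac⟩, hcard⟩ := h
  have lt_and {x y : ℕ} (hx : x < 128) : x &&& y < 128 := lt_of_le_of_lt Nat.and_le_left hx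
  have lt_or {x y : ℕ} (hx : x < 128) (hy : y < 128) : x ||| y < 128 :=
    Nat.or_lt_two_pow (n := 7) hx hy
  rw [← Ne, ← decode_nonempty_iff (lt_and ha.1), decode_and] at hab hac
  rw [← Ne, ← decode_nonempty_iff (lt_and hb.1), decode_and] at hbc
  rw [← card_decode _ (lt_or (lt_or ha.1 hb.1) hc.1), decode_or, decode_or] at hcard
  have hinter : decode a ∩ decode b ∩ decode c = ∅ := by
    rw [← decode_and, ← decode_and, habc]
    decide
  refine hc3 ⟨_, ha.2, _, hb.2, _, hc.2, ?_, ?_, ?_, hab, hbc, hac, hinter, hcard⟩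
  · intro h
    rw [h, Finset.inter_self] at hinter
    exact hbc.ne_empty hinter
  · intro h
    rw [h, Finset.inter_assoc, Finset.inter_self] at hinter
    exact hac.ne_empty hinter
  · intro h
    rw [h, Finset.inter_right_comm, Finset.inter_self, Finset.inter_comm] at hinter
    exact hbc.ne_empty hinter

theorem containsK4_eq_false (hk4 : ¬ HasK4 E) {ins : List ℕ} (hins : ∀ m ∈ ins, CodesEdge E m) :
    containsK4 ins = false := by
  rw [← Bool.not_eq_true]
  intro h
  simp only [containsK4, List.any_eq_true, List.all_eq_true, List.mem_range, Bool.or_eq_true,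
    Bool.not_eq_true', Nat.beq_eq] at h
  obtain ⟨s, hs, h⟩ := h
  rw [mem_codes] at hs
  refine hk4 ⟨decode s, by rw [card_decode s hs.1, hs.2], fun t hts ht => ?_⟩
  obtain ⟨i, hi⟩ : ∃ i, decode s \ t = {i} := by
    rw [← Finset.card_eq_one, Finset.card_sdiff_of_subset hts, card_decode s hs.1, hs.2, ht]
  have hmem : i ∈ decode s \ t := hi ▸ Finset.mem_singleton_self i
  have hbit : s.testBit i = true := by simpa [decode] using (Finset.mem_sdiff.1 hmem).1
  obtain hfalse | ⟨m, hm, rfl⟩ := h i i.isLt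
  · simp [hbit] at hfalse
  · convert (hins _ hm).2
    rw [decode_xor_one_shiftLeft s hs.1 i hbit, ← hi, Finset.sdiff_sdiff_eq_self hts]

theorem exists_of_embeds {B : List (ℕ × ℕ × ℕ)} {ins : List ℕ} :
    ∀ {Gs : List (List (ℕ × ℕ × ℕ))} {l : List ℕ}, embeds B ins Gs l = true →
      ∃ l' : List ℕ, l'.Perm (List.range 7) ∧ ∀ t ∈ B, imageCode l' t ∈ ins
  | [], l, h => by
    simp only [embeds, Bool.and_eq_true, List.isPerm_iff, List.all_eq_true, List.any_eq_true,
      Nat.beq_eq] at h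
    refine ⟨l, h.1, fun t ht => ?_⟩
    obtain ⟨m, hm, he⟩ := h.2 t ht
    exact he ▸ hm
  | G :: Gs, l, h => by
    simp only [embeds, List.any_eq_true, Bool.and_eq_true] at h
    obtain ⟨v, -, -, h⟩ := h
    exact exists_of_embeds h

theorem card_toHyp : ∀ B ∈ targets, (toHyp B).card = B.length := by
  decide +kernel

theorem lt_of_mem_target : ∀ B ∈ targets, ∀ t ∈ B, t.1 < 7 ∧ t.2.1 < 7 ∧ t.2.2 < 7 := by
  decide +kernel

theorem exists_perm_of_list {l : List ℕ} (hl : l.Perm (List.range 7)) :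
    ∃ σ : Equiv.Perm (Fin 7), ∀ i < 7, l.getD i 0 < 7 ∧
      σ (Fin.ofNat 7 i) = Fin.ofNat 7 (l.getD i 0) := by
  have hlen : l.length = 7 := by simpa using hl.length_eq
  have hlt (i : ℕ) (hi : i < 7) : l.getD i 0 < 7 := by
    have hi' : i < l.length := by rwa [hlen]
    rw [List.getD_eq_getElem l 0 hi']
    simpa using hl.subset (List.getElem_mem hi')
  have hlen' (i : Fin 7) : (i : ℕ) < l.length := by simp [hlen]
  have hinj : Function.Injective fun i : Fin 7 => (⟨l.getD i 0, hlt i i.isLt⟩ : Fin 7) := by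
    intro i j hij
    simp only [Fin.mk.injEq, List.getD_eq_getElem l 0 (hlen' _)] at hij
    exact Fin.ext ((hl.nodup_iff.2 List.nodup_range).getElem_inj_iff.1 hij)
  refine ⟨Equiv.ofBijective _ (Finite.injective_iff_bijective.1 hinj), fun i hi => ⟨hlt i hi, ?_⟩⟩
  ext
  simp only [Equiv.ofBijective_apply, Fin.ofNat, Nat.mod_eq_of_lt hi, Nat.mod_eq_of_lt (hlt i hi)]

theorem isTarget_of_isClassified (hk4 : ¬ HasK4 E) {ins : List ℕ}
    (hins : ∀ m ∈ ins, CodesEdge E m) (hE : ∀ e ∈ E, ∃ m ∈ ins, decode m = e)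
    (h : isClassified ins = true) : IsTarget E := by
  simp only [isClassified, containsK4_eq_false hk4 hins, Bool.false_or, List.any_eq_true,
    Bool.and_eq_true, Nat.beq_eq] at h
  obtain ⟨B, hB, hlen, hemb⟩ := h
  obtain ⟨l, hl, hlB⟩ := exists_of_embeds hemb
  obtain ⟨σ, hσ⟩ := exists_perm_of_list hl
  refine ⟨B, hB, σ, Finset.eq_of_subset_of_card_le ?_ ?_⟩
  · intro e he
    simp only [toHyp, Finset.mem_image, List.mem_toFinset, List.mem_map] at he
    obtain ⟨_, ⟨t, ht, rfl⟩, rfl⟩ := he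
    obtain ⟨h₁, h₂, h₃⟩ := lt_of_mem_target B hB t ht
    convert (hins _ (hlB t ht)).2
    rw [imageCode, decode_or, decode_or, decode_one_shiftLeft _ (hσ _ h₁).1,
      decode_one_shiftLeft _ (hσ _ h₂).1, decode_one_shiftLeft _ (hσ _ h₃).1]
    simp only [Finset.image_insert, Finset.image_singleton, (hσ _ h₁).2, (hσ _ h₂).2, (hσ _ h₃).2]
    simp only [Finset.insert_eq, Finset.union_assoc]
  · rw [Finset.card_image_of_injective _ (Finset.image_injective σ.injective), card_toHyp B hB,
      hlen]
    calc E.card ≤ (ins.toFinset.image decode).card :=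
          Finset.card_le_card fun e he => by simpa using hE e he
      _ ≤ ins.length := Finset.card_image_le.trans ins.toFinset_card_le

theorem isTarget_of_checkFree {bad : ℕ → ℕ → ℕ → Bool} (hu : IsUniform3 E) (hk4 : ¬ HasK4 E)
    (hbad : ∀ a b c, CodesEdge E a → CodesEdge E b → CodesEdge E c → bad a b c = false) :
    ∀ {free ins : List ℕ}, (∀ m ∈ free, m < 128) → IsBetween E ins free →
      checkFree bad free ins = true → IsTarget E
  | [], ins, _, hE, h => by
    refine isTarget_of_isClassified hk4 hE.lower (fun e he => ?_) h
    obtain ⟨m, hm, rfl⟩ := IsUniform3.exists_code hu he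
    exact ⟨m, by simpa using hE.upper m hm he, rfl⟩
  | c :: free, ins, hfree, hE, h => by
    simp only [checkFree, Bool.and_eq_true, Bool.or_eq_true, List.any_eq_true] at h
    rw [List.forall_mem_cons] at hfree
    by_cases hc : decode c ∈ E
    · have hcE : CodesEdge E c := ⟨hfree.1, hc⟩
      obtain ⟨a, ha, b, hb, hcab⟩ | h := h.2
      · simp [hbad c a b hcE (hE.lower a ha) (hE.lower b hb)] at hcab
      · refine isTarget_of_checkFree hu hk4 hbad hfree.2
          ⟨List.forall_mem_cons.2 ⟨hcE, hE.lower⟩, fun m hm hmE => ?_⟩ h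
        have := hE.upper m hm hmE
        simp only [List.mem_cons] at this ⊢
        tauto
    · refine isTarget_of_checkFree hu hk4 hbad hfree.2 ⟨hE.lower, fun m hm hmE => ?_⟩ h.1
      obtain h | h := hE.upper m hm hmE
      · exact .inl h
      · obtain rfl | h := List.mem_cons.1 h
        · exact absurd hmE hc
        · exact .inr h

/-- Among the edges avoiding a set of at most two vertices, there is one with least code. -/
theorem exists_least_code (hu : IsUniform3 E) (ht : ¬ HasSmallTransversal E) {T : ℕ}
    (hT : T ∈ codes 2) : ∃ c ∈ codes 3, decode c ∈ E ∧ c &&& T = 0 ∧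
      ∀ e ∈ codes 3, decode e ∈ E → e &&& T = 0 → c ≤ e := by
  have hex : ∃ c, c ∈ codes 3 ∧ decode c ∈ E ∧ c &&& T = 0 := by
    by_contra! hne
    refine ht ⟨decode T, by rw [card_decode T (mem_codes.1 hT).1, (mem_codes.1 hT).2],
      fun e he => ?_⟩
    obtain ⟨m, hm, rfl⟩ := IsUniform3.exists_code hu he
    rw [← decode_and, decode_nonempty_iff (lt_of_le_of_lt Nat.and_le_left (mem_codes.1 hm).1)]
    exact hne m hm he
  classical
  obtain ⟨h₁, h₂, h₃⟩ := Nat.find_spec hex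
  exact ⟨_, h₁, h₂, h₃, fun e he heE heT => Nat.find_min' hex ⟨he, heE, heT⟩⟩

theorem isTarget_of_checkPairs {bad : ℕ → ℕ → ℕ → Bool} (hE : Admissible E)
    (hbad : ∀ a b c, CodesEdge E a → CodesEdge E b → CodesEdge E c → bad a b c = false) :
    ∀ {Ts ins free : List ℕ}, (∀ T ∈ Ts, T ∈ codes 2) → (∀ m ∈ free, m < 128) →
      IsBetween E ins free → checkPairs bad Ts ins free = true → IsTarget E
  | [], _, _, _, hfree, hbt, h => isTarget_of_checkFree hE.uniform hE.noK4 hbad hfree hbt h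
  | T :: Ts, ins, free, hTs, hfree, hbt, h => by
    rw [List.forall_mem_cons] at hTs
    rw [checkPairs] at h
    split_ifs at h with hT
    · exact isTarget_of_checkPairs hE hbad hTs.2 hfree hbt h
    · simp only [List.any_eq_true, Nat.beq_eq, not_exists, not_and] at hT
      simp only [List.all_eq_true, List.mem_filter, Nat.beq_eq, and_imp] at h
      obtain ⟨c, hc, hcE, hcT, hmin⟩ := exists_least_code hE.uniform hE.transversal hTs.1
      have hcins : ∀ m ∈ c :: ins, CodesEdge E m :=
        List.forall_mem_cons.2 ⟨⟨(mem_codes.1 hc).1, hcE⟩, hbt.lower⟩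
      have hcfree : c ∈ free := (hbt.upper c hc hcE).resolve_left fun hmem => hT c hmem hcT
      refine isTarget_of_checkPairs hE hbad hTs.2 (fun m hm => hfree m (List.mem_filter.1 hm).1)
        ⟨hcins, fun m hm hmE => ?_⟩ (h c hcfree hcT)
      by_cases hmc : m = c
      · exact .inl (by simp [hmc])
      · refine (hbt.upper m hm hmE).imp (List.mem_cons_of_mem c) fun hmfree => ?_
        have hmin' : m &&& T = 0 → c < m := fun hmT =>
          lt_of_le_of_ne (hmin m hm hmE hmT) (Ne.symm hmc)
        have hgood : ((c :: ins).any fun a => bad c a m) = false := by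
          rw [List.any_eq_false]
          intro a ha
          simp [hbad c a m (hcins c (by simp)) (hcins a ha) ⟨(mem_codes.1 hm).1, hmE⟩]
        simp only [List.mem_filter, Bool.and_eq_true, Bool.or_eq_true, Bool.not_eq_true', hgood,
          ← Bool.not_eq_true, Nat.beq_eq, Nat.blt_eq]
        exact ⟨hmfree, (em (m &&& T = 0)).symm.imp id hmin', by simp⟩

theorem mem_image_image_iff (σ : Equiv.Perm (Fin 7)) {e : Finset (Fin 7)} :
    e.image σ ∈ E.image (Finset.image σ) ↔ e ∈ E :=
  (Finset.image_injective σ.injective).mem_finset_image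

theorem Admissible.image (hE : Admissible E) (σ : Equiv.Perm (Fin 7)) :
    Admissible (E.image (Finset.image σ)) where
  uniform := Finset.forall_mem_image.2 fun e he => by
    rw [Finset.card_image_of_injective _ σ.injective, hE.uniform e he]
  transversal := by
    rintro ⟨T, hT, h⟩
    refine hE.transversal ⟨T.image σ.symm, Finset.card_image_le.trans hT, fun e he => ?_⟩
    have := (h _ (Finset.mem_image_of_mem _ he)).image σ.symm
    simpa [Finset.image_inter _ _ σ.symm.injective, Finset.image_image] using this
  noC3 := by
    simp only [HasC3, Finset.exists_mem_image, ← Finset.image_inter _ _ σ.injective,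
      ← Finset.image_union, Finset.image_nonempty, Finset.image_eq_empty,
      Finset.card_image_of_injective _ σ.injective, (Finset.image_injective σ.injective).ne_iff]
    exact hE.noC3
  noK4 := by
    rintro ⟨S, hS, h⟩
    refine hE.noK4 ⟨S.image σ.symm, by rwa [Finset.card_image_of_injective _ σ.symm.injective],
      fun t hts ht => ?_⟩
    rw [← mem_image_image_iff σ]
    refine h _ ?_ (by rwa [Finset.card_image_of_injective _ σ.injective])
    simpa [Finset.image_image] using Finset.image_subset_image (f := σ) hts

theorem IsTarget.of_image {σ : Equiv.Perm (Fin 7)} (h : IsTarget (E.image (Finset.image σ))) :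
    IsTarget E := by
  obtain ⟨B, hB, τ, hτ⟩ := h
  refine ⟨B, hB, τ.trans σ.symm, ?_⟩
  apply Finset.image_injective (Finset.image_injective σ.injective)
  rw [← hτ, Finset.image_image]
  refine Finset.image_congr fun e _ => ?_
  simp [Finset.image_image, Function.comp_def]

theorem exists_perm_apply_eq {n : ℕ} (hn : n ≤ 7) {x : Fin n → Fin 7} (hx : Function.Injective x) :
    ∃ σ : Equiv.Perm (Fin 7), ∀ i, σ (x i) = Fin.castLE hn i := by
  have := Equiv.Perm.isMultiplyPretransitive (Fin 7) n
  obtain ⟨σ, hσ⟩ := MulAction.exists_smul_eq (Equiv.Perm (Fin 7)) (⟨x, hx⟩ : Fin n ↪ Fin 7)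
    (Fin.castLEEmb hn)
  exact ⟨σ, fun i => DFunLike.congr_fun hσ i⟩

theorem exists_image_eq {e : Finset (Fin 7)} (he : e.card = 3) :
    ∃ σ : Equiv.Perm (Fin 7), e.image σ = {0, 1, 2} := by
  obtain ⟨a, b, c, hab, hac, hbc, rfl⟩ := Finset.card_eq_three.1 he
  obtain ⟨σ, hσ⟩ := exists_perm_apply_eq (x := ![a, b, c]) (by decide) <| by
    intro i j; fin_cases i <;> fin_cases j <;> simp_all [eq_comm]
  refine ⟨σ, ?_⟩
  have h₀ : σ a = 0 := hσ 0
  have h₁ : σ b = 1 := hσ 1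
  have h₂ : σ c = 2 := hσ 2
  simp only [Finset.image_insert, Finset.image_singleton, h₀, h₁, h₂]

theorem exists_image_eq_image_eq {e f : Finset (Fin 7)} (he : e.card = 3) (hf : f.card = 3)
    (hef : (e ∩ f).card = 2) :
    ∃ σ : Equiv.Perm (Fin 7), e.image σ = {0, 1, 2} ∧ f.image σ = {0, 1, 3} := by
  obtain ⟨a, b, hab, hinter⟩ := Finset.card_eq_two.1 hef
  obtain ⟨c, hc⟩ : ∃ c, e \ f = {c} := by
    rw [← Finset.card_eq_one]
    have := Finset.card_sdiff_add_card_inter e f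
    omega
  obtain ⟨d, hd⟩ : ∃ d, f \ e = {d} := by
    rw [← Finset.card_eq_one]
    have := Finset.card_sdiff_add_card_inter f e
    rw [Finset.inter_comm] at this
    omega
  have ha : a ∈ e ∩ f := by simp [hinter]
  have hb : b ∈ e ∩ f := by simp [hinter]
  have hc' : c ∈ e \ f := by simp [hc]
  have hd' : d ∈ f \ e := by simp [hd]
  have hinj : Function.Injective ![a, b, c, d] := by
    have hac : a ≠ c := by grind
    have hbc : b ≠ c := by grind
    have had : a ≠ d := by grind
    have hbd : b ≠ d := by grind
    have hcd : c ≠ d := by grind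
    clear he hf
    intro i j
    fin_cases i <;> fin_cases j <;> simp_all [eq_comm]
  obtain ⟨σ, hσ⟩ := exists_perm_apply_eq (by decide) hinj
  have h₀ : σ a = 0 := hσ 0
  have h₁ : σ b = 1 := hσ 1
  have h₂ : σ c = 2 := hσ 2
  have h₃ : σ d = 3 := hσ 3
  refine ⟨σ, ?_, ?_⟩
  · rw [← Finset.sdiff_union_inter e f, hc, hinter]
    simp only [Finset.image_union, Finset.image_insert, Finset.image_singleton, h₀, h₁, h₂]
    decide
  · rw [← Finset.sdiff_union_inter f e, hd, Finset.inter_comm, hinter]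
    simp only [Finset.image_union, Finset.image_insert, Finset.image_singleton, h₀, h₁, h₃]
    decide

set_option maxHeartbeats 0 in
theorem checkPairs_linear :
    checkPairs (fun a _ c => Nat.beq (size (a &&& c)) 2) (codes 2) [7]
      ((codes 3).filter fun m => m != 7 && !Nat.beq (size (m &&& 7)) 2) = true := by
  decide +kernel

set_option maxHeartbeats 0 in
theorem checkPairs_sharing :
    checkPairs isC3 (codes 2) [11, 7]
      ((codes 3).filter fun m => m != 7 && m != 11 && !isC3 11 7 m) = true := by
  decide +kernel

theorem Admissible.isTarget_of_card_inter_eq_two (hE : Admissible E) {e f : Finset (Fin 7)}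
    (he : e ∈ E) (hf : f ∈ E) (hef : (e ∩ f).card = 2) : IsTarget E := by
  obtain ⟨σ, hσe, hσf⟩ := exists_image_eq_image_eq (hE.uniform e he) (hE.uniform f hf) hef
  have h7 : CodesEdge (E.image (Finset.image σ)) 7 :=
    ⟨by decide, (show decode 7 = {0, 1, 2} by decide) ▸ hσe ▸ Finset.mem_image_of_mem _ he⟩
  have h11 : CodesEdge (E.image (Finset.image σ)) 11 :=
    ⟨by decide, (show decode 11 = {0, 1, 3} by decide) ▸ hσf ▸ Finset.mem_image_of_mem _ hf⟩
  have hC3 := @isC3_eq_false _ (hE.image σ).noC3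
  refine IsTarget.of_image (isTarget_of_checkPairs (hE.image σ)
    (fun a b c ha hb hc => hC3 ha hb hc) (fun T hT => hT)
    (fun m hm => (mem_codes.1 (List.mem_filter.1 hm).1).1)
    ⟨by simp [h7, h11], fun m hm hmE => ?_⟩ checkPairs_sharing)
  have := hC3 h11 h7 ⟨(mem_codes.1 hm).1, hmE⟩
  simp only [List.mem_cons, List.not_mem_nil, List.mem_filter, hm, this, bne_iff_ne,
    Bool.and_eq_true, Bool.not_false, and_true, true_and, or_false]
  tauto

theorem Admissible.isTarget_of_card_inter_ne_two (hE : Admissible E)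
    (hlin : ∀ e ∈ E, ∀ f ∈ E, (e ∩ f).card ≠ 2) : IsTarget E := by
  obtain ⟨e, he⟩ : E.Nonempty := by
    rw [Finset.nonempty_iff_ne_empty]
    rintro rfl
    exact hE.transversal ⟨∅, by simp⟩
  obtain ⟨σ, hσ⟩ := exists_image_eq (hE.uniform e he)
  have h7 : CodesEdge (E.image (Finset.image σ)) 7 :=
    ⟨by decide, (show decode 7 = {0, 1, 2} by decide) ▸ hσ ▸ Finset.mem_image_of_mem _ he⟩
  have hsize {a b : ℕ} (ha : CodesEdge (E.image (Finset.image σ)) a)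
      (hb : CodesEdge (E.image (Finset.image σ)) b) : Nat.beq (size (a &&& b)) 2 = false := by
    obtain ⟨e, he, hae⟩ := Finset.mem_image.1 ha.2
    obtain ⟨f, hf, hbf⟩ := Finset.mem_image.1 hb.2
    rw [← Bool.not_eq_true, Nat.beq_eq, ← card_decode _ (lt_of_le_of_lt Nat.and_le_left ha.1),
      decode_and, ← hae, ← hbf, ← Finset.image_inter _ _ σ.injective,
      Finset.card_image_of_injective _ σ.injective]
    exact hlin e he f hf
  refine IsTarget.of_image (isTarget_of_checkPairs (hE.image σ)
    (fun a _ c ha _ hc => hsize ha hc) (fun T hT => hT)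
    (fun m hm => (mem_codes.1 (List.mem_filter.1 hm).1).1)
    ⟨by simp [h7], fun m hm hmE => ?_⟩ checkPairs_linear)
  have := hsize ⟨(mem_codes.1 hm).1, hmE⟩ h7
  simp only [List.mem_cons, List.not_mem_nil, List.mem_filter, hm, this, bne_iff_ne,
    Bool.and_eq_true, Bool.not_false, and_true, true_and, or_false]
  tauto

theorem Admissible.isTarget (hE : Admissible E) : IsTarget E := by
  by_cases hlin : ∀ e ∈ E, ∀ f ∈ E, (e ∩ f).card ≠ 2
  · exact hE.isTarget_of_card_inter_ne_two hlin
  · push Not at hlin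
    obtain ⟨e, he, f, hf, hef⟩ := hlin
    exact hE.isTarget_of_card_inter_eq_two he hf hef

theorem map_toHyp_targets :
    targets.map toHyp = [hypC7, hypD, hypDplus, hypC, hypFminus, hypF] := by
  decide +kernel

end SevenVertices

/-- Classification: a 3-uniform hypergraph on 7 vertices with transversal
number at least 3, containing neither `C₃⁽³⁾` nor `K₄⁽³⁾`, is isomorphic to
one of `C₇⁽³⁾`, the Fano plane `F`, `F⁻`, `C`, `D`, `D⁺`. -/
theorem classification_without_K4 (E : Finset (Finset (Fin 7)))
    (hu : IsUniform3 E) (htr : ¬ HasSmallTransversal E)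
    (hc3 : ¬ HasC3 E) (hk4 : ¬ HasK4 E) :
    HypIso hypC7 E ∨ HypIso hypF E ∨ HypIso hypFminus E ∨ HypIso hypC E ∨
      HypIso hypD E ∨ HypIso hypDplus E := by
  obtain ⟨B, hB, hiso⟩ := SevenVertices.Admissible.isTarget ⟨hu, htr, hc3, hk4⟩
  have hmem := List.mem_map_of_mem (f := SevenVertices.toHyp) hB
  rw [SevenVertices.map_toHyp_targets] at hmem
  simp only [List.mem_cons, List.not_mem_nil, or_false] at hmem
  obtain h | h | h | h | h | h := hmem <;> rw [h] at hiso
  · exact .inl hiso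
  · exact .inr (.inr (.inr (.inr (.inl hiso))))
  · exact .inr (.inr (.inr (.inr (.inr hiso))))
  · exact .inr (.inr (.inr (.inl hiso)))
  · exact .inr (.inr (.inl hiso))
  · exact .inr (.inl hiso)
end

section
/- Consider the nine convex sets of the counterexample construction (convex hulls of specified subsets of 12 points in ℝ², with the 12 points labeled by the 5-element index sets of the sets containing them: 01236, 01356, 01456, 01458, 02356, 02357, 02478, 02578, 04578, 13468, 14578, 23567). Then no point of ℝ² belongs to six or more of the nine sets. -/
/-- The twelve intersection-point labels of the nine-set counterexample: the
label of a point lists the (five) sets containing it. -/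
def pointLabels : Fin 12 → Finset (Fin 9) :=
  ![{0,1,2,3,6}, {0,1,3,5,6}, {0,1,4,5,6}, {0,1,4,5,8},
    {0,2,3,5,6}, {0,2,3,5,7}, {0,2,4,7,8}, {0,2,5,7,8},
    {0,4,5,7,8}, {1,3,4,6,8}, {1,4,5,7,8}, {2,3,5,6,7}]

/-- Integer coordinates of twelve points realizing the nine-set counterexample. -/
def gridPoint : Fin 12 → ℤ × ℤ :=
  ![(1, 0), (4, 1), (5, 1), (6, 2), (1, 1), (1, 2), (5, 6), (3, 5), (4, 4), (6, 0), (6, 4), (0, 1)]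

/-- The value at `v` of the affine function `(x, y) ↦ a x + b y + c`, where `f = (a, b, c)`. -/
def affineValue {R : Type*} [Ring R] (f : ℤ × ℤ × ℤ) (v : R × R) : R :=
  f.1 * v.1 + f.2.1 * v.2 + f.2.2

/-- Triples of sets with empty common intersection, each with three affine functions,
nonnegative on the respective sets, whose sum is a negative constant. -/
def emptyTriples :
    List ((Fin 9 × Fin 9 × Fin 9) × (ℤ × ℤ × ℤ) × (ℤ × ℤ × ℤ) × (ℤ × ℤ × ℤ)) :=
  [((0, 1, 7), (-4, -1, 26), (12, -15, -12), (-8, 16, -16)),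
   ((0, 3, 8), (-3, 3, 12), (-2, -6, 14), (5, 3, -30)),
   ((0, 6, 7), (1, 0, -1), (0, -2, 2), (-1, 2, -2)),
   ((1, 2, 5), (12, -15, -12), (-12, 8, 12), (0, 7, -7)),
   ((1, 3, 7), (16, -20, -16), (-3, -6, 18), (-13, 26, -26)),
   ((2, 4, 5), (-21, 14, 21), (22, -11, -44), (-1, -3, 18)),
   ((2, 4, 6), (-6, 4, 6), (6, -3, -12), (0, -1, 1)),
   ((3, 4, 5), (-1, -2, 6), (1, 1, -6), (0, 1, -1)),
   ((5, 6, 8), (-1, 1, 4), (-4, -4, 24), (5, 3, -30))]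

/-- The affine function `f` is nonnegative on the points whose label contains `i`. -/
def NonnegOnLabel (f : ℤ × ℤ × ℤ) (i : Fin 9) : Prop :=
  ∀ m, i ∈ pointLabels m → 0 ≤ affineValue f (gridPoint m)

instance (f : ℤ × ℤ × ℤ) (i : Fin 9) : Decidable (NonnegOnLabel f i) :=
  inferInstanceAs (Decidable (∀ _, _))

/-- The points of `gridPoint`, viewed in the real plane. -/
def planePoint (m : Fin 12) : ℝ × ℝ := ((gridPoint m).1, (gridPoint m).2)

/-- The convex hull of the points whose label contains `i`. -/
def labelHull (i : Fin 9) : Set (ℝ × ℝ) :=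
  convexHull ℝ (planePoint '' {m | i ∈ pointLabels m})

theorem convex_nonneg_affineValue (f : ℤ × ℤ × ℤ) :
    Convex ℝ {v : ℝ × ℝ | 0 ≤ affineValue f v} := by
  intro v hv w hw s t hs ht hst
  simp only [affineValue, Set.mem_ofPred_eq, Prod.fst_add, Prod.snd_add, Prod.smul_fst,
    Prod.smul_snd, smul_eq_mul] at hv hw ⊢
  have h := add_nonneg (mul_nonneg hs hv) (mul_nonneg ht hw)
  obtain rfl : t = 1 - s := by linarith
  linarith

theorem NonnegOnLabel.affineValue_nonneg {f : ℤ × ℤ × ℤ} {i : Fin 9}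
    (h : NonnegOnLabel f i) {x : ℝ × ℝ} (hx : x ∈ labelHull i) : 0 ≤ affineValue f x := by
  refine convexHull_min ?_ (convex_nonneg_affineValue f) hx
  rintro _ ⟨m, hm, rfl⟩
  have := h m hm
  simp only [affineValue, planePoint, Set.mem_ofPred_eq] at this ⊢
  exact_mod_cast this

theorem emptyTriples_valid : ∀ c ∈ emptyTriples,
    NonnegOnLabel c.2.1 c.1.1 ∧ NonnegOnLabel c.2.2.1 c.1.2.1 ∧
      NonnegOnLabel c.2.2.2 c.1.2.2 ∧
      (c.2.1 + c.2.2.1 + c.2.2.2).1 = 0 ∧ (c.2.1 + c.2.2.1 + c.2.2.2).2.1 = 0 ∧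
      (c.2.1 + c.2.2.1 + c.2.2.2).2.2 < 0 := by
  decide +kernel

theorem exists_emptyTriple_of_five_lt_card : ∀ s : Finset (Fin 9), 5 < s.card →
    ∃ c ∈ emptyTriples, c.1.1 ∈ s ∧ c.1.2.1 ∈ s ∧ c.1.2.2 ∈ s := by
  decide +kernel

theorem card_le_five_of_forall_mem_labelHull {x : ℝ × ℝ} {s : Finset (Fin 9)}
    (hs : ∀ i ∈ s, x ∈ labelHull i) : s.card ≤ 5 := by
  by_contra! hcard
  obtain ⟨⟨⟨i, j, k⟩, f, g, h⟩, hc, hi, hj, hk⟩ := exists_emptyTriple_of_five_lt_card s hcard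
  obtain ⟨hf, hg, hh, h₁, h₂, h₃⟩ := emptyTriples_valid _ hc
  have hfx := hf.affineValue_nonneg (hs i hi)
  have hgx := hg.affineValue_nonneg (hs j hj)
  have hhx := hh.affineValue_nonneg (hs k hk)
  simp only [affineValue, Prod.fst_add, Prod.snd_add] at *
  have h₁' : (f.1 + g.1 + h.1 : ℝ) = 0 := by exact_mod_cast h₁
  have h₂' : (f.2.1 + g.2.1 + h.2.1 : ℝ) = 0 := by exact_mod_cast h₂
  have h₃' : (f.2.2 + g.2.2 + h.2.2 : ℝ) < 0 := by exact_mod_cast h₃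
  refine absurd h₃' (not_lt.mpr ?_)
  linear_combination hfx + hgx + hhx + x.1 * h₁' + x.2 * h₂'

theorem planePoint_mem_labelHull {m : Fin 12} {i : Fin 9} (h : i ∈ pointLabels m) :
    planePoint m ∈ labelHull i :=
  subset_convexHull ℝ _ ⟨m, h, rfl⟩

theorem card_pointLabels : ∀ m, (pointLabels m).card = 5 := by
  decide

/-- There is a placement of the twelve points in the plane such that, taking
for each `i ∈ {0,…,8}` the convex hull of the points whose label contains `i`,
each of the twelve points lies exactly in the sets given by its label, and no
point of the plane belongs to six or more of the nine sets. -/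
theorem nine_sets_no_six_cover :
    ∃ p : Fin 12 → ℝ × ℝ,
      (∀ m : Fin 12, ∀ i : Fin 9,
        (p m ∈ convexHull ℝ (p '' {m' | i ∈ pointLabels m'}) ↔ i ∈ pointLabels m)) ∧
      ∀ x : ℝ × ℝ,
        ({i : Fin 9 | x ∈ convexHull ℝ (p '' {m | i ∈ pointLabels m})}).ncard ≤ 5 := by
  refine ⟨planePoint, fun m i => ⟨fun h => ?_, planePoint_mem_labelHull⟩, fun x => ?_⟩
  · by_contra hi
    have hcard : (insert i (pointLabels m)).card ≤ 5 :=
      card_le_five_of_forall_mem_labelHull (x := planePoint m) fun j hj => by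
        obtain rfl | hj := Finset.mem_insert.mp hj
        exacts [h, planePoint_mem_labelHull hj]
    rw [Finset.card_insert_of_notMem hi, card_pointLabels] at hcard
    omega
  · classical
    rw [Set.ncard_eq_toFinset_card']
    exact card_le_five_of_forall_mem_labelHull (x := x) fun i hi => by
      rw [Set.mem_toFinset] at hi
      exact hi
end
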